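/- arXiv:2502.07739 — 3 statements merged into one kernel-verified Lean document; each statement's English description precedes it below -/
import Mathlib

section
/- Consider classic LoRA gradient flow (η_A = η_B = η) for matrix factorization, and fix a singular value decomposition M = U_M Σ_M V_Mᵀ with U_M ∈ ℝ^{b×b} and V_M ∈ ℝ^{a×a} orthogonal. If the matrices U_Mᵀ X_0 V_M, V_Mᵀ Y_0 V_M and U_Mᵀ Z_0 U_M are all diagonal with only their first r diagonal entries possibly nonzero, then for every t ≥ 0 the matrices U_Mᵀ X_t V_M, V_Mᵀ Y_t V_M and U_Mᵀ Z_t U_M are diagonal with only their first r diagonal entries possibly nonzero. -/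
open Matrix MeasureTheory Filter Topology

noncomputable section

/-- The measurable space structure on matrices (the product σ-algebra). -/
instance matrixMeasurableSpace {m n : Type*} : MeasurableSpace (Matrix m n ℝ) :=
  show MeasurableSpace (m → n → ℝ) from inferInstance

/-- Squared Frobenius norm of a real matrix. -/
def fnormSq {m n : ℕ} (M : Matrix (Fin m) (Fin n) ℝ) : ℝ := ∑ i, ∑ j, M i j ^ 2

/-- Frobenius norm of a real matrix. -/
def fnorm {m n : ℕ} (M : Matrix (Fin m) (Fin n) ℝ) : ℝ := Real.sqrt (fnormSq M)

/-- `X = (α/r) • B Aᵀ`, the LoRA update associated with adapters `A`, `B`. -/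
def lX {a b r : ℕ} (α : ℝ) (A : Matrix (Fin a) (Fin r) ℝ) (B : Matrix (Fin b) (Fin r) ℝ) :
    Matrix (Fin b) (Fin a) ℝ := (α / (r : ℝ)) • (B * Aᵀ)

/-- `Y = (α/r) • A Aᵀ`. -/
def lY {a r : ℕ} (α : ℝ) (A : Matrix (Fin a) (Fin r) ℝ) : Matrix (Fin a) (Fin a) ℝ :=
  (α / (r : ℝ)) • (A * Aᵀ)

/-- `Z = (α/r) • B Bᵀ`. -/
def lZ {b r : ℕ} (α : ℝ) (B : Matrix (Fin b) (Fin r) ℝ) : Matrix (Fin b) (Fin b) ℝ :=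
  (α / (r : ℝ)) • (B * Bᵀ)

/-- `G = (α/r) • (X - M)`, the gradient of the matrix-factorization loss. -/
def lG {a b r : ℕ} (α : ℝ) (M : Matrix (Fin b) (Fin a) ℝ) (A : Matrix (Fin a) (Fin r) ℝ)
    (B : Matrix (Fin b) (Fin r) ℝ) : Matrix (Fin b) (Fin a) ℝ :=
  (α / (r : ℝ)) • (lX α A B - M)

/-- The LoRA gradient flow on `[0, ∞)` for the matrix-factorization objective, with learning
rates `ηA` for the adapter `A` and `ηB` for the adapter `B`:
`dA/dt = -ηA Gᵀ B`, `dB/dt = -ηB G A`, stated entrywise. -/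
def LoraFlow {a b r : ℕ} (α ηA ηB : ℝ) (M : Matrix (Fin b) (Fin a) ℝ)
    (A : ℝ → Matrix (Fin a) (Fin r) ℝ) (B : ℝ → Matrix (Fin b) (Fin r) ℝ) : Prop :=
  ∀ t, (0 : ℝ) ≤ t →
    (∀ i j, HasDerivAt (fun s => A s i j) (((-ηA) • ((lG α M (A t) (B t))ᵀ * B t)) i j) t) ∧
    (∀ i j, HasDerivAt (fun s => B s i j) (((-ηB) • (lG α M (A t) (B t) * A t)) i j) t)

/-- The rectangular `b × a` diagonal matrix with diagonal entries `σ 0, σ 1, …`. -/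
def svdDiag (b a : ℕ) (σ : ℕ → ℝ) : Matrix (Fin b) (Fin a) ℝ :=
  Matrix.of fun i j => if (i : ℕ) = (j : ℕ) then σ (i : ℕ) else 0

/-- `M = U Σ Vᵀ` is a singular value decomposition of `M` with (nonincreasing, nonnegative)
singular values `σ 0 ≥ σ 1 ≥ …`, so that `σ i` is the `(i+1)`-th largest singular value,
the columns of `U` are corresponding left singular vectors and the columns of `V` are
corresponding right singular vectors. -/
def IsSVD {b a : ℕ} (M : Matrix (Fin b) (Fin a) ℝ) (U : Matrix (Fin b) (Fin b) ℝ)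
    (V : Matrix (Fin a) (Fin a) ℝ) (σ : ℕ → ℝ) : Prop :=
  U * Uᵀ = 1 ∧ Uᵀ * U = 1 ∧ V * Vᵀ = 1 ∧ Vᵀ * V = 1 ∧
    (∀ i j, i ≤ j → σ j ≤ σ i) ∧ (∀ i, 0 ≤ σ i) ∧ (∀ i, min a b ≤ i → σ i = 0) ∧
    M = U * svdDiag b a σ * Vᵀ

/-- `N` is a (possibly rectangular) diagonal matrix whose only possibly nonzero entries are
the first `r` diagonal ones. -/
def DiagOnFirst (r : ℕ) {m n : ℕ} (N : Matrix (Fin m) (Fin n) ℝ) : Prop :=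
  ∀ (i : Fin m) (j : Fin n), ((i : ℕ) ≠ (j : ℕ) ∨ r ≤ (i : ℕ)) → N i j = 0

/-- Gronwall step: entries of `N` on `bad` pairs stay zero under `N' = K N + N K`. -/
theorem bad_zero {ι : Type} [Fintype ι] (N K : ℝ → ι → ι → ℝ) (bad : ι → ι → Prop) (d : ℝ)
    (hd : 0 ≤ d)
    (h1 : ∀ t, 0 ≤ t → ∀ i j,
      HasDerivAt (fun s => N s i j) (∑ k, (K t i k * N t k j + N t i k * K t k j)) t)
    (h2 : ∀ t, 0 ≤ t → ∀ i j, ContinuousAt (fun s => K s i j) t)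
    (h3 : ∀ i j k, bad i j → bad k j ∨ (bad i k ∧ ∀ t, |K t i k| ≤ d * |N t i k|))
    (h4 : ∀ i j k, bad i j → bad i k ∨ (bad k j ∧ ∀ t, |K t k j| ≤ d * |N t k j|))
    (h0 : ∀ i j, bad i j → N 0 i j = 0) :
    ∀ t, 0 ≤ t → ∀ i j, bad i j → N t i j = 0 := by
  classical
  intro T hT
  have bd : ∀ F : ℝ → ι → ι → ℝ, (∀ t, 0 ≤ t → ∀ i j, ContinuousAt (fun s => F s i j) t) →
      ∃ C, 0 ≤ C ∧ ∀ t ∈ Set.Icc 0 T, ∀ i j, |F t i j| ≤ C := by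
    intro F hF
    have hc : ContinuousOn (fun t => ∑ i, ∑ j, |F t i j|) (Set.Icc 0 T) := by
      refine continuousOn_finsetSum _ fun i _ => continuousOn_finsetSum _ fun j _ => ?_
      exact fun t ht => ((hF t ht.1 i j).abs).continuousWithinAt
    obtain ⟨C, hC⟩ := isCompact_Icc.exists_bound_of_continuousOn hc
    refine ⟨C, (norm_nonneg _).trans (hC 0 ⟨le_rfl, hT⟩), fun t ht i j => ?_⟩
    have e := (le_abs_self _).trans (hC t ht)
    refine le_trans ?_ e
    refine le_trans ?_ (Finset.single_le_sum (f := fun i => ∑ j, |F t i j|)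
      (fun i _ => Finset.sum_nonneg fun j _ => abs_nonneg _) (Finset.mem_univ i))
    exact Finset.single_le_sum (f := fun j => |F t i j|)
      (fun j _ => abs_nonneg _) (Finset.mem_univ j)
  obtain ⟨CK, hCK0, hCK⟩ := bd K h2
  obtain ⟨CN, hCN0, hCN⟩ := bd N (fun t ht i j => (h1 t ht i j).continuousAt)
  set E : ℝ → ι → ι → ℝ := fun t i j => if bad i j then N t i j else 0 with hE
  set E' : ℝ → ι → ι → ℝ := fun t i j =>
    if bad i j then ∑ k, (K t i k * N t k j + N t i k * K t k j) else 0 with hE'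
  have hder : ∀ t, 0 ≤ t → HasDerivAt E (E' t) t := by
    intro t ht
    refine hasDerivAt_pi.2 fun i => hasDerivAt_pi.2 fun j => ?_
    by_cases hb : bad i j
    · simpa [hE, hE', hb] using h1 t ht i j
    · simpa [hE, hE', hb] using hasDerivAt_const t (0:ℝ)
  have hNE : ∀ t i j, bad i j → |N t i j| ≤ ‖E t‖ := by
    intro t i j hb
    have := (norm_le_pi_norm (E t i) j).trans (norm_le_pi_norm (E t) i)
    simpa [hE, hb] using this
  set C := CK + d * CN with hC
  have hCnn : 0 ≤ C := by positivity
  have hbound : ∀ t ∈ Set.Ico 0 T,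
      ‖E' t‖ ≤ ((Fintype.card ι : ℝ) * (2 * C)) * ‖E t‖ + 0 := by
    intro t ht
    have ht' : t ∈ Set.Icc 0 T := ⟨ht.1, ht.2.le⟩
    have hEn := norm_nonneg (E t)
    have hnn : 0 ≤ ((Fintype.card ι : ℝ) * (2 * C)) * ‖E t‖ + 0 := by positivity
    refine (pi_norm_le_iff_of_nonneg hnn).2 fun i => (pi_norm_le_iff_of_nonneg hnn).2 fun j => ?_
    by_cases hb : bad i j
    · simp only [hE', hb, if_true]
      have key : ∀ k, ‖K t i k * N t k j + N t i k * K t k j‖ ≤ 2 * C * ‖E t‖ := by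
        intro k
        have e1 : |K t i k * N t k j| ≤ C * ‖E t‖ := by
          rw [abs_mul]
          rcases h3 i j k hb with h | ⟨h, h'⟩
          · have := mul_le_mul (hCK t ht' i k) (hNE t k j h) (abs_nonneg _) hCK0
            have : 0 ≤ d * CN * ‖E t‖ := by positivity
            rw [hC]; linarith
          · have u1 : |K t i k| ≤ d * ‖E t‖ :=
              (h' t).trans (mul_le_mul_of_nonneg_left (hNE t i k h) hd)
            have := mul_le_mul u1 (hCN t ht' k j) (abs_nonneg _) (by positivity)
            have : 0 ≤ CK * ‖E t‖ := by positivity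
            rw [hC]; linarith
        have e2 : |N t i k * K t k j| ≤ C * ‖E t‖ := by
          rw [abs_mul]
          rcases h4 i j k hb with h | ⟨h, h'⟩
          · have := mul_le_mul (hNE t i k h) (hCK t ht' k j) (abs_nonneg _) hEn
            have : 0 ≤ d * CN * ‖E t‖ := by positivity
            rw [hC]; linarith
          · have u1 : |K t k j| ≤ d * ‖E t‖ :=
              (h' t).trans (mul_le_mul_of_nonneg_left (hNE t k j h) hd)
            have := mul_le_mul (hCN t ht' i k) u1 (abs_nonneg _) hCN0
            have : 0 ≤ CK * ‖E t‖ := by positivity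
            rw [hC]; linarith
        refine (norm_add_le _ _).trans ?_
        simp only [Real.norm_eq_abs]
        linarith
      refine (norm_sum_le _ _).trans ((Finset.sum_le_sum fun k _ => key k).trans ?_)
      simp only [Finset.sum_const, Finset.card_univ, nsmul_eq_mul]
      linarith
    · simp only [hE', hb, if_false, norm_zero]
      exact hnn
  have hE0 : ‖E 0‖ ≤ 0 := by
    have : E 0 = 0 := by
      funext i j
      by_cases hb : bad i j
      · simp [hE, hb, h0 i j hb]
      · simp [hE, hb]
    simp [this]
  have g := norm_le_gronwallBound_of_norm_deriv_right_le
    (fun t ht => (hder t ht.1).continuousAt.continuousWithinAt)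
    (fun t ht => (hder t ht.1).hasDerivWithinAt) hE0 hbound T ⟨hT, le_rfl⟩
  rw [gronwallBound_ε0_δ0] at g
  intro i j hb
  exact abs_nonpos_iff.1 ((hNE T i j hb).trans g)

/-- Pushing left multiplication by a constant matrix through the derivative. -/
theorem hasDeriv_mul {m n p : ℕ} (V : Matrix (Fin m) (Fin n) ℝ) (A : ℝ → Matrix (Fin n) (Fin p) ℝ)
    (A' : Matrix (Fin n) (Fin p) ℝ) (t : ℝ)
    (h : ∀ i j, HasDerivAt (fun s => A s i j) (A' i j) t) (i : Fin m) (j : Fin p) :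
    HasDerivAt (fun s => (V * A s) i j) ((V * A') i j) t := by
  simp only [Matrix.mul_apply]
  exact HasDerivAt.fun_sum fun k _ => (h k j).const_mul _

/-- The label of a row of the stacked matrix. -/
def lab {a b : ℕ} : Fin a ⊕ Fin b → ℕ := Sum.elim (fun i => (i : ℕ)) (fun i => (i : ℕ))

theorem rot_core (a b r : ℕ) (c η : ℝ) (hc : 0 < c) (hη : 0 < η) (σ : ℕ → ℝ)
    (P : ℝ → Matrix (Fin a) (Fin r) ℝ) (Q : ℝ → Matrix (Fin b) (Fin r) ℝ)
    (hP : ∀ t, 0 ≤ t → ∀ i j, HasDerivAt (fun s => P s i j)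
      (((-η) • ((c • (c • (Q t * (P t)ᵀ) - svdDiag b a σ))ᵀ * Q t)) i j) t)
    (hQ : ∀ t, 0 ≤ t → ∀ i j, HasDerivAt (fun s => Q s i j)
      (((-η) • ((c • (c • (Q t * (P t)ᵀ) - svdDiag b a σ)) * P t)) i j) t)
    (hX0 : DiagOnFirst r (Q 0 * (P 0)ᵀ)) (hY0 : DiagOnFirst r (P 0 * (P 0)ᵀ))
    (hZ0 : DiagOnFirst r (Q 0 * (Q 0)ᵀ)) (t : ℝ) (ht : 0 ≤ t) :
    DiagOnFirst r (Q t * (P t)ᵀ) ∧ DiagOnFirst r (P t * (P t)ᵀ) ∧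
      DiagOnFirst r (Q t * (Q t)ᵀ) := by
  set G : ℝ → Matrix (Fin b) (Fin a) ℝ := fun t => c • (c • (Q t * (P t)ᵀ) - svdDiag b a σ) with hG
  set W : ℝ → Fin a ⊕ Fin b → Fin r → ℝ := fun t => Sum.elim (fun i l => P t i l)
    (fun i l => Q t i l) with hW
  set K : ℝ → Fin a ⊕ Fin b → Fin a ⊕ Fin b → ℝ := fun t => Sum.elim
    (fun i => Sum.elim (fun _ => 0) (fun j => -η * G t j i))
    (fun i => Sum.elim (fun j => -η * G t i j) (fun _ => 0)) with hK
  set N : ℝ → Fin a ⊕ Fin b → Fin a ⊕ Fin b → ℝ := fun t i j => ∑ l, W t i l * W t j l with hN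
  have Ksymm : ∀ t i j, K t i j = K t j i := by
    rintro t (i | i) (j | j) <;> simp [hK]
  have Nsymm : ∀ t i j, N t i j = N t j i := by
    intro t i j; simp only [hN]; exact Finset.sum_congr rfl fun l _ => mul_comm _ _
  have hWd : ∀ t, 0 ≤ t → ∀ i l, HasDerivAt (fun s => W s i l) (∑ k, K t i k * W t k l) t := by
    rintro t ht (i | i) l
    · refine (hP t ht i l).congr_deriv ?_
      simp [hK, hW, hG, Matrix.mul_apply, Finset.mul_sum, mul_assoc]
      simp only [mul_comm (P t i _)]
    · refine (hQ t ht i l).congr_deriv ?_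
      simp [hK, hW, hG, Matrix.mul_apply, Finset.mul_sum, mul_assoc]
  have hWc : ∀ t, 0 ≤ t → ∀ i l, ContinuousAt (fun s => W s i l) t :=
    fun t ht i l => (hWd t ht i l).continuousAt
  have hNd : ∀ t, 0 ≤ t → ∀ i j, HasDerivAt (fun s => N s i j)
      (∑ k, (K t i k * N t k j + N t i k * K t k j)) t := by
    intro t ht i j
    have := HasDerivAt.fun_sum (u := Finset.univ) fun l _ => (hWd t ht i l).fun_mul (hWd t ht j l)
    refine this.congr_deriv ?_
    simp only [hN, Finset.sum_add_distrib, Finset.mul_sum, Finset.sum_mul]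
    congr 1
    · rw [Finset.sum_comm]
      exact Finset.sum_congr rfl fun _ _ => Finset.sum_congr rfl fun _ _ => by ring
    · rw [Finset.sum_comm]
      refine Finset.sum_congr rfl fun _ _ => Finset.sum_congr rfl fun _ _ => ?_
      rw [Ksymm t j]; ring
  have hGN : ∀ t i j, G t i j = c * (c * N t (Sum.inr i) (Sum.inl j) - svdDiag b a σ i j) := by
    intro t i j
    simp [hG, hN, hW, Matrix.mul_apply]
  have hKc : ∀ t, 0 ≤ t → ∀ i j, ContinuousAt (fun s => K s i j) t := by
    have hGc : ∀ t, 0 ≤ t → ∀ i j, ContinuousAt (fun s => -η * G s i j) t := by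
      intro t ht i j
      simp only [hGN]
      have := (hNd t ht (Sum.inr i) (Sum.inl j)).continuousAt
      fun_prop
    rintro t ht (i | i) (j | j)
    · exact continuousAt_const
    · exact hGc t ht j i
    · exact hGc t ht i j
    · exact continuousAt_const
  have hKb : ∀ i k, lab i ≠ lab k → ∀ t, |K t i k| ≤ (η * c * c) * |N t i k| := by
    have hGb : ∀ t (i : Fin b) (j : Fin a), (i : ℕ) ≠ j →
        |-η * G t i j| ≤ (η * c * c) * |N t (Sum.inr i) (Sum.inl j)| := by
      intro t i j hij
      rw [hGN]
      simp only [svdDiag, Matrix.of_apply, if_neg hij, sub_zero, abs_mul, abs_neg,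
        abs_of_pos hc, abs_of_pos hη]
      apply le_of_eq; ring
    rintro (i | i) (j | j) h t
    · simp only [hK, Sum.elim_inl, abs_zero]; positivity
    · rw [Nsymm]; exact hGb t j i (fun e => h e.symm)
    · exact hGb t i j h
    · simp only [hK, Sum.elim_inr, abs_zero]; positivity
  have main := bad_zero N K (fun i j => lab i ≠ lab j ∨ r ≤ lab i) (η * c * c) (by positivity)
    hNd hKc
    (by
      intro i j k hb
      by_cases h : lab k ≠ lab j ∨ r ≤ lab k
      · exact Or.inl h
      · push Not at h
        have hik : lab i ≠ lab k := by rcases hb with hb | hb <;> omega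
        exact Or.inr ⟨Or.inl hik, hKb i k hik⟩)
    (by
      intro i j k hb
      by_cases h : lab i ≠ lab k ∨ r ≤ lab i
      · exact Or.inl h
      · push Not at h
        have hik : lab k ≠ lab j := by rcases hb with hb | hb <;> omega
        exact Or.inr ⟨Or.inl hik, hKb k j hik⟩)
    (by
      rintro (i | i) (j | j) hb
      · simpa [hN, hW, Matrix.mul_apply] using hY0 i j hb
      · rw [Nsymm]
        have : (j : ℕ) ≠ (i : ℕ) ∨ r ≤ (j : ℕ) := by
          simp only [lab, Sum.elim_inl, Sum.elim_inr] at hb; omega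
        simpa [hN, hW, Matrix.mul_apply] using hX0 j i this
      · simpa [hN, hW, Matrix.mul_apply] using hX0 i j hb
      · simpa [hN, hW, Matrix.mul_apply] using hZ0 i j hb) t ht
  refine ⟨fun i j h => ?_, fun i j h => ?_, fun i j h => ?_⟩
  · simpa [hN, hW, Matrix.mul_apply] using main (Sum.inr i) (Sum.inl j) h
  · simpa [hN, hW, Matrix.mul_apply] using main (Sum.inl i) (Sum.inl j) h
  · simpa [hN, hW, Matrix.mul_apply] using main (Sum.inr i) (Sum.inr j) h

theorem diag_smul_iff {m n : ℕ} (r : ℕ) (c : ℝ) (hc : c ≠ 0) (N : Matrix (Fin m) (Fin n) ℝ) :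
    DiagOnFirst r (c • N) ↔ DiagOnFirst r N := by
  simp [DiagOnFirst, hc]

/-- For classic LoRA gradient flow (`ηA = ηB = η`) and a fixed SVD
`M = U_M Σ_M V_Mᵀ`: if `U_Mᵀ X₀ V_M`, `V_Mᵀ Y₀ V_M` and `U_Mᵀ Z₀ U_M` are diagonal with only
their first `r` diagonal entries possibly nonzero, the same holds at every time `t ≥ 0`. -/
theorem statement15
    (a b r : ℕ) (hr0 : 0 < r) (hr : r ≤ min a b)
    (α η : ℝ) (hα : 0 < α) (hη : 0 < η)
    (M : Matrix (Fin b) (Fin a) ℝ)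
    (UM : Matrix (Fin b) (Fin b) ℝ) (VM : Matrix (Fin a) (Fin a) ℝ) (σ : ℕ → ℝ)
    (hsvd : IsSVD M UM VM σ)
    (A : ℝ → Matrix (Fin a) (Fin r) ℝ) (B : ℝ → Matrix (Fin b) (Fin r) ℝ)
    (hflow : LoraFlow α η η M A B)
    (hX0 : DiagOnFirst r (UMᵀ * lX α (A 0) (B 0) * VM))
    (hY0 : DiagOnFirst r (VMᵀ * lY α (A 0) * VM))
    (hZ0 : DiagOnFirst r (UMᵀ * lZ α (B 0) * UM)) :
    ∀ t, (0:ℝ) ≤ t →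
      DiagOnFirst r (UMᵀ * lX α (A t) (B t) * VM) ∧
      DiagOnFirst r (VMᵀ * lY α (A t) * VM) ∧
      DiagOnFirst r (UMᵀ * lZ α (B t) * UM) := by
  obtain ⟨hU1, hU2, hV1, hV2, -, -, -, hM⟩ := hsvd
  have hc : 0 < α / (r : ℝ) := div_pos hα (by exact_mod_cast hr0)
  have eX : ∀ t, UMᵀ * lX α (A t) (B t) * VM
      = (α / (r : ℝ)) • ((UMᵀ * B t) * (VMᵀ * A t)ᵀ) := by
    intro t
    simp [lX, Matrix.transpose_mul, Matrix.mul_assoc]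
  have eY : ∀ t, VMᵀ * lY α (A t) * VM = (α / (r : ℝ)) • ((VMᵀ * A t) * (VMᵀ * A t)ᵀ) := by
    intro t
    simp [lY, Matrix.transpose_mul, Matrix.mul_assoc]
  have eZ : ∀ t, UMᵀ * lZ α (B t) * UM = (α / (r : ℝ)) • ((UMᵀ * B t) * (UMᵀ * B t)ᵀ) := by
    intro t
    simp [lZ, Matrix.transpose_mul, Matrix.mul_assoc]
  have eG : ∀ t, (α / (r : ℝ)) • ((α / (r : ℝ)) • ((UMᵀ * B t) * (VMᵀ * A t)ᵀ) - svdDiag b a σ)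
      = UMᵀ * lG α M (A t) (B t) * VM := by
    intro t
    have h2 : UMᵀ * M * VM = svdDiag b a σ := by
      rw [hM]
      calc UMᵀ * (UM * svdDiag b a σ * VMᵀ) * VM
          = (UMᵀ * UM) * svdDiag b a σ * (VMᵀ * VM) := by simp only [Matrix.mul_assoc]
        _ = _ := by rw [hU2, hV2, Matrix.one_mul, Matrix.mul_one]
    rw [← eX, ← h2, lG, Matrix.mul_smul, Matrix.smul_mul, Matrix.mul_sub, Matrix.sub_mul]
  simp only [eX, eY, eZ, diag_smul_iff r _ hc.ne'] at hX0 hY0 hZ0 ⊢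
  refine rot_core a b r (α / (r : ℝ)) η hc hη σ (fun t => VMᵀ * A t) (fun t => UMᵀ * B t)
    ?_ ?_ hX0 hY0 hZ0
  · intro t ht i j
    have := hasDeriv_mul VMᵀ A _ t (hflow t ht).1 i j
    convert this using 1
    simp only [eG]
    have : (UMᵀ * lG α M (A t) (B t) * VM)ᵀ * (UMᵀ * B t)
        = VMᵀ * ((lG α M (A t) (B t))ᵀ * B t) := by
      calc _ = VMᵀ * ((lG α M (A t) (B t))ᵀ * ((UM * UMᵀ) * B t)) := by
            simp only [Matrix.transpose_mul, Matrix.transpose_transpose, Matrix.mul_assoc]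
        _ = _ := by rw [hU1, Matrix.one_mul]
    rw [this, Matrix.mul_smul]
  · intro t ht i j
    have := hasDeriv_mul UMᵀ B _ t (hflow t ht).2 i j
    convert this using 1
    simp only [eG]
    have : (UMᵀ * lG α M (A t) (B t) * VM) * (VMᵀ * A t)
        = UMᵀ * (lG α M (A t) (B t) * A t) := by
      calc _ = UMᵀ * (lG α M (A t) (B t) * ((VM * VMᵀ) * A t)) := by
            simp only [Matrix.mul_assoc]
        _ = _ := by rw [hV1, Matrix.one_mul]
    rw [this, Matrix.mul_smul]

end
end

section
/- Let η > 0, σ > 0 and c > 0, and let x_t be the solution of the ODE dx/dt = −η(x − σ)·√(c² + 2x²) with x_0 = 0. Then for all t ≥ 0, 0 ≤ σ − x_t ≤ σ · exp[−(ηct/2)·(1 + √(1 + (2σ²/c²)·(1 − e^{−ηct/2})²))]. -/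
open Matrix MeasureTheory Filter Topology

noncomputable section

/-- Exponential decay on an interval where the rate is at least `k`. -/
theorem decay_aux (η σ c : ℝ) (hη : 0 < η) (x : ℝ → ℝ)
    (hx : ∀ t, (0:ℝ) ≤ t →
      HasDerivAt x (-η * (x t - σ) * Real.sqrt (c ^ 2 + 2 * x t ^ 2)) t)
    (hle : ∀ t, (0:ℝ) ≤ t → x t ≤ σ) (a b k : ℝ) (ha : 0 ≤ a) (hab : a ≤ b)
    (hk : ∀ s, a ≤ s → s ≤ b → k ≤ Real.sqrt (c ^ 2 + 2 * x s ^ 2)) :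
    σ - x b ≤ (σ - x a) * Real.exp (-(η * k * (b - a))) := by
  have hd : ∀ s, 0 ≤ s → HasDerivAt (fun s => (σ - x s) * Real.exp (η * k * s))
      (-(-η * (x s - σ) * Real.sqrt (c ^ 2 + 2 * x s ^ 2)) * Real.exp (η * k * s)
        + (σ - x s) * (Real.exp (η * k * s) * (η * k * 1))) s := by
    intro s hs
    exact ((hx s hs).const_sub σ).mul (((hasDerivAt_id s).const_mul (η * k)).exp)
  have hanti : AntitoneOn (fun s => (σ - x s) * Real.exp (η * k * s)) (Set.Icc a b) := by
    apply antitoneOn_of_deriv_nonpos (convex_Icc a b)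
    · intro s hs
      exact (hd s (ha.trans hs.1)).continuousAt.continuousWithinAt
    · intro s hs
      rw [interior_Icc] at hs
      exact (hd s (ha.trans hs.1.le)).differentiableAt.differentiableWithinAt
    · intro s hs
      rw [interior_Icc] at hs
      rw [(hd s (ha.trans hs.1.le)).deriv]
      have h1 := hk s hs.1.le hs.2.le
      have h2 := hle s (ha.trans hs.1.le)
      have h3 : 0 ≤ η * Real.exp (η * k * s) * (σ - x s)
          * (Real.sqrt (c ^ 2 + 2 * x s ^ 2) - k) :=
        mul_nonneg (mul_nonneg (by positivity) (by linarith)) (by linarith)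
      linarith
  have h := hanti (Set.left_mem_Icc.2 hab) (Set.right_mem_Icc.2 hab) hab
  simp only at h
  have h4 := mul_le_mul_of_nonneg_right h (Real.exp_pos (-(η * k * b))).le
  rw [mul_assoc (σ - x b), mul_assoc (σ - x a), ← Real.exp_add, ← Real.exp_add] at h4
  rw [show η * k * b + -(η * k * b) = 0 by ring, Real.exp_zero, mul_one,
    show η * k * a + -(η * k * b) = -(η * k * (b - a)) by ring] at h4
  exact h4

/-- If `x` solves `x' = -η(x - σ)√(c² + 2x²)` for `t ≥ 0` with `x₀ = 0`
(`η, σ, c > 0`), then for all `t ≥ 0`,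
`0 ≤ σ - xₜ ≤ σ exp[-(ηct/2)(1 + √(1 + (2σ²/c²)(1 - e^{-ηct/2})²))]`. -/
theorem statement17
    (η σ c : ℝ) (hη : 0 < η) (hσ : 0 < σ) (hc : 0 < c)
    (x : ℝ → ℝ) (hx0 : x 0 = 0)
    (hx : ∀ t, (0:ℝ) ≤ t →
      HasDerivAt x (-η * (x t - σ) * Real.sqrt (c ^ 2 + 2 * x t ^ 2)) t) :
    ∀ t, (0:ℝ) ≤ t →
      0 ≤ σ - x t ∧
      σ - x t ≤ σ * Real.exp (-(η * c * t / 2) *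
        (1 + Real.sqrt (1 + 2 * σ ^ 2 / c ^ 2 *
          (1 - Real.exp (-(η * c * t / 2))) ^ 2))) := by
  have hle : ∀ t, (0:ℝ) ≤ t → x t ≤ σ := by
    intro t ht
    apply le_of_forall_pos_le_add
    intro ε hε
    refine image_le_of_deriv_right_lt_deriv_boundary' (a := 0) (b := t)
      (B := fun _ => σ + ε) (B' := fun _ => 0)
      (fun s hs => (hx s hs.1).continuousAt.continuousWithinAt)
      (fun s hs => (hx s hs.1).hasDerivWithinAt) (by rw [hx0]; linarith)
      continuousOn_const (fun s _ => hasDerivWithinAt_const _ _ _) ?_ (Set.right_mem_Icc.2 ht)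
    intro s hs h
    have hp : 0 < Real.sqrt (c ^ 2 + 2 * x s ^ 2) := Real.sqrt_pos.2 (by positivity)
    have h1 : x s - σ = ε := by rw [h]; ring
    rw [h1]
    have : 0 < η * ε * Real.sqrt (c ^ 2 + 2 * x s ^ 2) := by positivity
    linarith
  have hck : ∀ s, c ≤ Real.sqrt (c ^ 2 + 2 * x s ^ 2) := fun s =>
    Real.le_sqrt_of_sq_le (by nlinarith [sq_nonneg (x s)])
  intro t ht
  refine ⟨by linarith [hle t ht], ?_⟩
  set E := Real.exp (-(η * c * t / 2)) with hE
  have hE1 : E ≤ 1 := Real.exp_le_one_iff.2 (by have : 0 ≤ η * c * t := by positivity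
                                                linarith)
  set R := Real.sqrt (1 + 2 * σ ^ 2 / c ^ 2 * (1 - E) ^ 2) with hR
  have hlow : ∀ s, t / 2 ≤ s → σ * (1 - E) ≤ x s := by
    intro s hs
    have h := decay_aux η σ c hη x hx hle 0 s c le_rfl (by linarith) (fun s _ _ => hck s)
    rw [hx0] at h
    have h2 : Real.exp (-(η * c * (s - 0))) ≤ E := by
      apply Real.exp_le_exp.2
      have := mul_le_mul_of_nonneg_left hs (mul_pos hη hc).le
      linarith
    have := mul_le_mul_of_nonneg_left h2 hσ.le
    linarith
  have h1 := decay_aux η σ c hη x hx hle 0 (t / 2) c le_rfl (by linarith) (fun s _ _ => hck s)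
  have h2 := decay_aux η σ c hη x hx hle (t / 2) t (c * R) (by linarith) (by linarith) (by
    intro s hs _
    apply Real.le_sqrt_of_sq_le
    rw [mul_pow, hR, Real.sq_sqrt (by positivity)]
    have h3 : (σ * (1 - E)) ^ 2 ≤ x s ^ 2 :=
      pow_le_pow_left₀ (mul_nonneg hσ.le (by linarith)) (hlow s hs) 2
    have h4 : c ^ 2 * (1 + 2 * σ ^ 2 / c ^ 2 * (1 - E) ^ 2)
        = c ^ 2 + 2 * (σ * (1 - E)) ^ 2 := by
      field_simp
    linarith)
  rw [hx0, sub_zero] at h1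
  refine h2.trans ((mul_le_mul_of_nonneg_right h1 (Real.exp_pos _).le).trans (le_of_eq ?_))
  rw [mul_assoc, ← Real.exp_add]
  congr 2
  ring

end
end

section
/- Let M ∈ ℝ^{b×a}, let P ∈ ℝ^{b×b} be an orthogonal projection of rank k, set X̂ = PM, let r ≤ k, and let Π ∈ ℝ^{a×a} be the orthogonal projection onto a subspace spanned by orthonormal right singular vectors of X̂ corresponding to its r largest singular values. Then ‖X̂Π − M‖_F² ≤ ‖X̂ − M‖_F² + Σ_{i=r+1}^{k} σ_i(M)². -/
open Matrix MeasureTheory Filter Topology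

noncomputable section

theorem aux_fnormSq {m n : ℕ} (M : Matrix (Fin m) (Fin n) ℝ) : fnormSq M = (Mᵀ * M).trace := by
  unfold fnormSq
  rw [Finset.sum_comm]
  simp [Matrix.trace, Matrix.mul_apply, pow_two]

theorem aux_gram {b a : ℕ} {M : Matrix (Fin b) (Fin a) ℝ} {U : Matrix (Fin b) (Fin b) ℝ}
    {V : Matrix (Fin a) (Fin a) ℝ} {σ : ℕ → ℝ} (h : IsSVD M U V σ) :
    Mᵀ * M = V * Matrix.diagonal (fun j : Fin a => σ j ^ 2) * Vᵀ := by
  obtain ⟨h1, h2, h3, h4, h5, h6, h7, h8⟩ := h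
  have hD : (svdDiag b a σ)ᵀ * svdDiag b a σ = Matrix.diagonal (fun j : Fin a => σ j ^ 2) := by
    ext i j
    simp only [Matrix.mul_apply, Matrix.transpose_apply, svdDiag, Matrix.of_apply,
      Matrix.diagonal_apply]
    by_cases hb : (i : ℕ) < b
    · rw [Finset.sum_eq_single (⟨i, hb⟩ : Fin b)]
      · by_cases hij : i = j
        · subst hij; simp [pow_two]
        · have : (i : ℕ) ≠ j := fun h => hij (Fin.ext h)
          simp [hij, this]
      · intro x _ hx
        have : (x : ℕ) ≠ i := fun h => hx (Fin.ext h)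
        simp [this]
      · simp
    · rw [Finset.sum_eq_zero]
      · have : σ i = 0 := h7 _ (by omega)
        simp [this]
      · intro x _
        have : (x : ℕ) ≠ i := by have := x.2; omega
        simp [this]
  calc Mᵀ * M = V * ((svdDiag b a σ)ᵀ * (Uᵀ * U) * svdDiag b a σ) * Vᵀ := by
        rw [h8]; simp only [Matrix.transpose_mul, Matrix.transpose_transpose, Matrix.mul_assoc]
    _ = _ := by rw [h2, Matrix.mul_one, hD]

theorem aux_quad {b a : ℕ} {M : Matrix (Fin b) (Fin a) ℝ} {U : Matrix (Fin b) (Fin b) ℝ}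
    {V : Matrix (Fin a) (Fin a) ℝ} {σ : ℕ → ℝ} (h : IsSVD M U V σ) (v : Fin a → ℝ) :
    (M *ᵥ v) ⬝ᵥ (M *ᵥ v) = ∑ j : Fin a, σ j ^ 2 * ((Vᵀ *ᵥ v) j) ^ 2 := by
  have : (M *ᵥ v) ⬝ᵥ (M *ᵥ v) = v ⬝ᵥ ((Mᵀ * M) *ᵥ v) := by
    rw [← Matrix.mulVec_mulVec, Matrix.dotProduct_mulVec v, Matrix.vecMul_transpose]
  rw [this, aux_gram h, ← Matrix.mulVec_mulVec, ← Matrix.mulVec_mulVec,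
    Matrix.dotProduct_mulVec, ← Matrix.mulVec_transpose]
  simp only [dotProduct, Matrix.mulVec_diagonal]
  exact Finset.sum_congr rfl fun j _ => by ring

theorem aux_norm {a : ℕ} {V : Matrix (Fin a) (Fin a) ℝ} (h : V * Vᵀ = 1) (v : Fin a → ℝ) :
    ∑ j : Fin a, ((Vᵀ *ᵥ v) j) ^ 2 = v ⬝ᵥ v := by
  have : (Vᵀ *ᵥ v) ⬝ᵥ (Vᵀ *ᵥ v) = v ⬝ᵥ v := by
    rw [Matrix.dotProduct_mulVec, Matrix.vecMul_transpose, Matrix.mulVec_mulVec, h,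
      Matrix.one_mulVec]
  rw [← this]
  simp [dotProduct, pow_two]

theorem aux_proj {b : ℕ} {P : Matrix (Fin b) (Fin b) ℝ} (hPsymm : Pᵀ = P) (hPidem : P * P = P)
    (w : Fin b → ℝ) : (P *ᵥ w) ⬝ᵥ (P *ᵥ w) ≤ w ⬝ᵥ w := by
  have e : (P *ᵥ w) ⬝ᵥ (P *ᵥ w) = w ⬝ᵥ (P *ᵥ w) := by
    rw [Matrix.dotProduct_mulVec, ← Matrix.mulVec_transpose, hPsymm, Matrix.mulVec_mulVec, hPidem,
      dotProduct_comm]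
  have h0 : 0 ≤ (w - P *ᵥ w) ⬝ᵥ (w - P *ᵥ w) :=
    Finset.sum_nonneg fun i _ => mul_self_nonneg _
  rw [sub_dotProduct, dotProduct_sub, dotProduct_sub, e, dotProduct_comm (P *ᵥ w) w] at h0
  linarith

theorem aux_weyl {b a : ℕ} {M X : Matrix (Fin b) (Fin a) ℝ}
    {U U' : Matrix (Fin b) (Fin b) ℝ} {V V' : Matrix (Fin a) (Fin a) ℝ} {σ τ : ℕ → ℝ}
    (h : IsSVD M U V σ) (h' : IsSVD X U' V' τ)
    (hle : ∀ v, (X *ᵥ v) ⬝ᵥ (X *ᵥ v) ≤ (M *ᵥ v) ⬝ᵥ (M *ᵥ v)) (i : Fin a) :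
    τ i ^ 2 ≤ σ i ^ 2 := by
  let N : Matrix (Fin a) (Fin a) ℝ := Matrix.of fun j l =>
    if j < i then Vᵀ j l else if i < j then V'ᵀ j l else 0
  have hdet : N.det = 0 := Matrix.det_eq_zero_of_row_eq_zero i (fun l => by simp [N])
  obtain ⟨v, hv0, hv⟩ := Matrix.exists_mulVec_eq_zero_iff.mpr hdet
  have hV : ∀ j, j < i → (Vᵀ *ᵥ v) j = 0 := by
    intro j hj
    have := congrFun hv j
    simpa [N, Matrix.mulVec, dotProduct, hj] using this
  have hV' : ∀ j, i < j → (V'ᵀ *ᵥ v) j = 0 := by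
    intro j hj
    have := congrFun hv j
    simpa [N, Matrix.mulVec, dotProduct, hj, hj.not_gt] using this
  have hpos : 0 < v ⬝ᵥ v := by
    have h0 : 0 ≤ v ⬝ᵥ v := Finset.sum_nonneg fun i _ => mul_self_nonneg _
    exact lt_of_le_of_ne h0 fun e => hv0 (dotProduct_self_eq_zero.mp e.symm)
  have key := hle v
  rw [aux_quad h, aux_quad h'] at key
  have l1 : τ i ^ 2 * (v ⬝ᵥ v) ≤ ∑ j : Fin a, τ j ^ 2 * ((V'ᵀ *ᵥ v) j) ^ 2 := by
    rw [← aux_norm h'.2.2.1 v, Finset.mul_sum]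
    refine Finset.sum_le_sum fun j _ => ?_
    rcases lt_or_ge i j with hj | hj
    · simp [hV' j hj]
    · have := h'.2.2.2.2.1 j i hj
      have := h'.2.2.2.2.2.1 i
      gcongr
  have l2 : ∑ j : Fin a, σ j ^ 2 * ((Vᵀ *ᵥ v) j) ^ 2 ≤ σ i ^ 2 * (v ⬝ᵥ v) := by
    rw [← aux_norm h.2.2.1 v, Finset.mul_sum]
    refine Finset.sum_le_sum fun j _ => ?_
    rcases lt_or_ge j i with hj | hj
    · simp [hV j hj]
    · have := h.2.2.2.2.1 i j hj
      have := h.2.2.2.2.2.1 j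
      gcongr
  exact le_of_mul_le_mul_right (l1.trans (key.trans l2)) hpos

theorem aux_rank {b a : ℕ} {X : Matrix (Fin b) (Fin a) ℝ}
    {U : Matrix (Fin b) (Fin b) ℝ} {V : Matrix (Fin a) (Fin a) ℝ} {σ : ℕ → ℝ}
    (h : IsSVD X U V σ) (k : ℕ) (hk : X.rank ≤ k) (i : Fin a) (hi : k ≤ i) : σ i = 0 := by
  by_contra hne
  have hd : Matrix.diagonal (fun j : Fin a => σ j ^ 2) = Vᵀ * (Xᵀ * X) * V := by
    rw [aux_gram h]
    have h4 := h.2.2.2.1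
    calc _ = (Vᵀ * V) * Matrix.diagonal (fun j : Fin a => σ j ^ 2) * (Vᵀ * V) := by
          rw [h4]; simp
      _ = _ := by simp only [Matrix.mul_assoc]
  have hr : (Matrix.diagonal (fun j : Fin a => σ j ^ 2)).rank ≤ k := by
    rw [hd]
    exact (Matrix.rank_mul_le_left _ _).trans ((Matrix.rank_mul_le_right _ _).trans
      ((Matrix.rank_mul_le_right _ _).trans hk))
  rw [Matrix.rank_diagonal, Fintype.card_subtype] at hr
  have hsub : Finset.Iic i ⊆ Finset.univ.filter (fun j : Fin a => σ j ^ 2 ≠ 0) := by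
    intro j hj
    rw [Finset.mem_Iic] at hj
    have h1 := h.2.2.2.2.1 j i hj
    have h2 : 0 < σ i := lt_of_le_of_ne (h.2.2.2.2.2.1 i) (Ne.symm hne)
    have h3 : 0 < σ j := lt_of_lt_of_le h2 h1
    simp [h3.ne']
  have hc := Finset.card_le_card hsub
  rw [Fin.card_Iic] at hc
  omega

/-- Let `P` be a `b × b` orthogonal projection of rank `k`, `X̂ = P M`,
`r ≤ k`, and let `Π` be the orthogonal projection onto the span of orthonormal right singular
vectors of `X̂` corresponding to its `r` largest singular values (the first `r` columns of the
`V`-factor of an SVD of `X̂`). Then `‖X̂ Π - M‖_F² ≤ ‖X̂ - M‖_F² + Σ_{i=r+1}^{k} σᵢ(M)²`. -/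
theorem statement18
    (b a k r : ℕ) (hrk : r ≤ k)
    (M : Matrix (Fin b) (Fin a) ℝ)
    (P : Matrix (Fin b) (Fin b) ℝ) (hPsymm : Pᵀ = P) (hPidem : P * P = P)
    (hPrank : P.rank = k)
    (UM : Matrix (Fin b) (Fin b) ℝ) (VM : Matrix (Fin a) (Fin a) ℝ) (σM : ℕ → ℝ)
    (hsvdM : IsSVD M UM VM σM)
    (UX : Matrix (Fin b) (Fin b) ℝ) (VX : Matrix (Fin a) (Fin a) ℝ) (σX : ℕ → ℝ)
    (hsvdX : IsSVD (P * M) UX VX σX) :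
    fnormSq (P * M *
        (VX * Matrix.diagonal (fun i : Fin a => if (i : ℕ) < r then (1:ℝ) else 0) * VXᵀ) - M)
      ≤ fnormSq (P * M - M) + ∑ i ∈ Finset.Ico r k, σM i ^ 2 := by
  set E : Matrix (Fin a) (Fin a) ℝ :=
    Matrix.diagonal (fun i : Fin a => if (i : ℕ) < r then (1:ℝ) else 0) with hE
  set X := P * M with hX
  have hPX : P * X = X := by rw [hX, ← Matrix.mul_assoc, hPidem]
  have hVV := hsvdX.2.2.1
  have hVV' := hsvdX.2.2.2.1
  -- the residual `X (1 - Π)`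
  set R := X * (VX * (1 - E) * VXᵀ) with hR
  have hdec : X * (VX * E * VXᵀ) - M = (X - M) - R := by
    have : VX * (1 - E) * VXᵀ = 1 - VX * E * VXᵀ := by
      rw [Matrix.mul_sub, Matrix.sub_mul, Matrix.mul_one, hVV]
    rw [hR, this, Matrix.mul_sub, Matrix.mul_one]
    abel
  have hcross : (X - M)ᵀ * R = 0 := by
    have h1 : (X - M)ᵀ * P = 0 := by
      have : (P * (X - M))ᵀ = 0 := by rw [Matrix.mul_sub, hPX, ← hX]; simp
      rwa [Matrix.transpose_mul, hPsymm] at this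
    rw [hR, ← hPX, Matrix.mul_assoc P X, ← Matrix.mul_assoc, hPX, h1, Matrix.zero_mul]
  have hcross' : Rᵀ * (X - M) = 0 := by
    have := congrArg Matrix.transpose hcross
    simpa [Matrix.transpose_mul] using this
  have hpyth : fnormSq (X * (VX * E * VXᵀ) - M) = fnormSq (X - M) + fnormSq R := by
    rw [hdec, aux_fnormSq, aux_fnormSq, aux_fnormSq, Matrix.transpose_sub (X - M) R,
      Matrix.sub_mul, Matrix.mul_sub _ (X - M) R, Matrix.mul_sub _ (X - M) R, hcross, hcross', ← Matrix.trace_add]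
    congr 1
    abel
  have hR2 : fnormSq R = ∑ j : Fin a, if (j : ℕ) < r then 0 else σX j ^ 2 := by
    have hE1 : 1 - E = Matrix.diagonal (fun i : Fin a => if (i : ℕ) < r then (0:ℝ) else 1) := by
      rw [hE, ← Matrix.diagonal_one, Matrix.diagonal_sub]
      congr 1; ext i; split_ifs <;> simp
    have hg := aux_gram hsvdX
    have : Rᵀ * R = VX * ((1 - E)ᵀ * (VXᵀ * VX)
        * Matrix.diagonal (fun j : Fin a => σX j ^ 2) * (VXᵀ * VX) * (1 - E)) * VXᵀ := by
      calc Rᵀ * R = VX * (1 - E)ᵀ * VXᵀ * (Xᵀ * X) * (VX * (1 - E) * VXᵀ) := by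
            rw [hR]
            simp only [Matrix.transpose_mul, Matrix.transpose_transpose, Matrix.mul_assoc]
        _ = _ := by rw [hg]; simp only [Matrix.mul_assoc]
    rw [aux_fnormSq, this, Matrix.trace_mul_comm, ← Matrix.mul_assoc, hVV', hE1]
    simp only [Matrix.one_mul, Matrix.mul_one, Matrix.diagonal_transpose,
      Matrix.diagonal_mul_diagonal, Matrix.trace_diagonal]
    refine Finset.sum_congr rfl fun j _ => ?_
    split_ifs <;> simp
  rw [hpyth, hR2]
  gcongr
  have hrank : X.rank ≤ k := hPrank ▸ Matrix.rank_mul_le_left P M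
  calc ∑ j : Fin a, (if (j : ℕ) < r then 0 else σX j ^ 2)
      ≤ ∑ j : Fin a, (fun n : ℕ => if n ∈ Finset.Ico r k then σM n ^ 2 else 0) j := by
        refine Finset.sum_le_sum fun j _ => ?_
        have hw := aux_weyl hsvdM hsvdX (fun v => by
          rw [hX, ← Matrix.mulVec_mulVec]; exact aux_proj hPsymm hPidem _) j
        by_cases h1 : (j : ℕ) < r
        · have : ¬ r ≤ (j : ℕ) := by omega
          simp [h1, this]
        · by_cases h2 : (j : ℕ) < k
          · have : r ≤ (j : ℕ) := by omega
            simpa [h1, h2, this] using hw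
          · have := aux_rank hsvdX k hrank j (by omega)
            simp [h2, this]
    _ = ∑ n ∈ Finset.range a, (if n ∈ Finset.Ico r k then σM n ^ 2 else 0) :=
        Fin.sum_univ_eq_sum_range (fun n : ℕ => if n ∈ Finset.Ico r k then σM n ^ 2 else 0) a
    _ ≤ ∑ n ∈ Finset.Ico r k, σM n ^ 2 := by
        rw [← Finset.sum_filter]
        refine Finset.sum_le_sum_of_subset_of_nonneg ?_ fun _ _ _ => sq_nonneg _
        intro n hn
        exact (Finset.mem_filter.mp hn).2

end
end
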